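/- Let C be a smooth projective plane curve of degree 4 (a smooth plane quartic) over a number field k. Then every quadratic arithmetic progression sequence on C is of finite length. -/

import Mathlib

open MvPolynomial

set_option synthInstance.maxHeartbeats 400000
set_option maxHeartbeats 1000000

noncomputable section

/-- `F` defines a smooth projective plane curve of degree `d` over `k`: it is homogeneous of
degree `d` and, over the algebraic closure of `k`, `F` and its partial derivatives have no
common nontrivial zero (the Jacobian criterion for smoothness of the plane curve `F = 0`). -/
def IsSmoothPlaneCurve {k : Type} [Field k] (d : ℕ) (F : MvPolynomial (Fin 3) k) : Prop :=
  F.IsHomogeneous d ∧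
    ∀ P : Fin 3 → AlgebraicClosure k, P ≠ 0 →
      ∃ i : Fin 3, eval P (map (algebraMap k (AlgebraicClosure k)) (pderiv i F)) ≠ 0

namespace Polynomial
open scoped Polynomial

section Hensel

variable {R : Type*} [CommRing R]

theorem mem_ideal_map_C_iff_map_mk_eq_zero {J : Ideal R} {f : R[X]} :
    f ∈ J.map (C : R →+* R[X]) ↔ f.map (Ideal.Quotient.mk J) = 0 := by
  rw [Ideal.mem_map_C_iff, Polynomial.ext_iff]
  simp [Ideal.Quotient.eq_zero_iff_mem]

theorem Monic.modByMonic_mem_map_C {J : Ideal R} {f h : R[X]} (hh : h.Monic)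
    (hf : f ∈ J.map (C : R →+* R[X])) : f %ₘ h ∈ J.map (C : R →+* R[X]) := by
  rw [mem_ideal_map_C_iff_map_mk_eq_zero] at *
  rw [map_modByMonic _ hh, hf, zero_modByMonic]

theorem Monic.divByMonic_mem_map_C {J : Ideal R} {f h : R[X]} (hh : h.Monic)
    (hf : f ∈ J.map (C : R →+* R[X])) : f /ₘ h ∈ J.map (C : R →+* R[X]) := by
  rw [mem_ideal_map_C_iff_map_mk_eq_zero] at *
  rw [map_divByMonic _ hh, hf, zero_divByMonic]

theorem Monic.mem_map_C_of_mul_left_mem {J : Ideal R} {f h : R[X]} (hh : h.Monic)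
    (hf : h * f ∈ J.map (C : R →+* R[X])) : f ∈ J.map (C : R →+* R[X]) := by
  simpa [mul_divByMonic_cancel_left f hh] using hh.divByMonic_mem_map_C hf

theorem Monic.mem_map_C_of_sub_mul_mem {J : Ideal R} {r h s : R[X]} (hh : h.Monic)
    (hr : r.degree < h.degree) (hf : r - h * s ∈ J.map (C : R →+* R[X])) :
    r ∈ J.map (C : R →+* R[X]) := by
  have := hh.modByMonic_mem_map_C hf
  nontriviality R
  rw [sub_modByMonic, self_mul_modByMonic hh, sub_zero] at this
  rwa [(modByMonic_eq_self_iff hh).2 hr] at this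

/-- Hensel lifting of a coprime factorization into monic polynomials, modulo a power of an ideal. -/
theorem exists_monic_mul_sub_mem_pow (J : Ideal R) {g h₀ q₀ u v : R[X]} (hg : g.Monic)
    (hh₀ : h₀.Monic) (hq₀ : q₀.Monic) (hdeg : g.natDegree = h₀.natDegree + q₀.natDegree)
    (hg₀ : g - h₀ * q₀ ∈ J.map (C : R →+* R[X]))
    (huv : u * h₀ + v * q₀ - 1 ∈ J.map (C : R →+* R[X])) (M : ℕ) :
    ∃ h q : R[X], h.Monic ∧ q.Monic ∧ h.natDegree = h₀.natDegree ∧ q.natDegree = q₀.natDegree ∧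
      h - h₀ ∈ J.map (C : R →+* R[X]) ∧ q - q₀ ∈ J.map (C : R →+* R[X]) ∧
      g - h * q ∈ (J ^ (M + 1)).map (C : R →+* R[X]) := by
  nontriviality R
  simp only [Ideal.map_pow] at *
  set 𝒥 := J.map (C : R →+* R[X]) with h𝒥
  induction M with
  | zero => exact ⟨h₀, q₀, hh₀, hq₀, rfl, rfl, by simp, by simp, by simpa using hg₀⟩
  | succ M ih =>
    obtain ⟨h, q, hh, hq, hhd, hqd, hhc, hqc, he⟩ := ih
    set e := g - h * q with hedef
    have hpow : ∀ n, 𝒥 ^ n = (J ^ n).map (C : R →+* R[X]) := fun n => (Ideal.map_pow _ _ _).symm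
    have huv' : u * h + v * q - 1 ∈ 𝒥 := by
      have : u * h + v * q - 1 =
        (u * h₀ + v * q₀ - 1) + (u * (h - h₀) + v * (q - q₀)) := by ring
      rw [this]
      exact add_mem huv (add_mem (Ideal.mul_mem_left _ _ hhc) (Ideal.mul_mem_left _ _ hqc))
    have hgd : g.degree = (h * q).degree := by
      rw [degree_eq_natDegree hg.ne_zero, degree_eq_natDegree (hh.mul hq).ne_zero,
        hh.natDegree_mul hq, hdeg, hhd, hqd]
    have hed : e.degree < (h * q).degree := by
      rw [← hgd]
      exact degree_sub_lt_left hgd hg.ne_zero (by rw [hg.leadingCoeff, (hh.mul hq).leadingCoeff])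
    set r := (e * v) %ₘ h with hr
    set s := (e * v) /ₘ h with hs
    have hrs : r + h * s = e * v := modByMonic_add_div _ h
    have hrd : r.degree < h.degree := degree_modByMonic_lt _ hh
    have hrmem : r ∈ 𝒥 ^ (M + 1) := by
      rw [hpow] at he ⊢
      exact hh.modByMonic_mem_map_C (Ideal.mul_mem_right _ _ he)
    have hed' : (e - r * q).degree < (h * q).degree := by
      refine (degree_sub_le _ _).trans_lt (max_lt hed ?_)
      rw [hq.degree_mul, hq.degree_mul]
      exact WithBot.add_lt_add_right (degree_ne_bot.2 hq.ne_zero) hrd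
    set α := (e - r * q) /ₘ h with hα
    set ρ := (e - r * q) %ₘ h with hρ
    have hαρ : ρ + h * α = e - r * q := modByMonic_add_div _ h
    have hρmem : ρ ∈ 𝒥 ^ (M + 2) := by
      have h1 : (e - r * q) - h * (s * q + e * u) ∈ 𝒥 ^ (M + 2) := by
        have : (e - r * q) - h * (s * q + e * u) = - (e * (u * h + v * q - 1)) := by
          linear_combination (-q) * hrs
        rw [this, pow_succ]
        exact neg_mem (Ideal.mul_mem_mul he huv')
      rw [hpow] at h1 ⊢
      have := hh.modByMonic_mem_map_C h1
      rwa [sub_modByMonic, self_mul_modByMonic hh, sub_zero] at this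
    have hαmem : α ∈ 𝒥 ^ (M + 1) := by
      have : e - r * q ∈ 𝒥 ^ (M + 1) := sub_mem he (Ideal.mul_mem_right _ _ hrmem)
      rw [hpow] at this ⊢
      exact hh.divByMonic_mem_map_C this
    have hαd : α.degree < q.degree := by
      by_contra hcon
      push Not at hcon
      have h1 : (h * q).degree ≤ (h * α).degree := by
        rw [mul_comm h q, mul_comm h α, hh.degree_mul, hh.degree_mul]
        gcongr
      have h2 : h * α = (e - r * q) - ρ := by rw [← hαρ]; ring
      have h3 : (h * α).degree < (h * q).degree := by
        rw [h2]
        refine (degree_sub_le _ _).trans_lt (max_lt hed' ?_)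
        refine (degree_modByMonic_lt _ hh).trans_le ?_
        rw [hq.degree_mul, degree_eq_natDegree hq.ne_zero]
        exact le_add_of_nonneg_right (by positivity)
      exact absurd h1 (not_le.2 h3)
    have hle : 𝒥 ^ (M + 1) ≤ 𝒥 := Ideal.pow_le_self (by simp)
    refine ⟨h + r, q + α, hh.add_of_left hrd, hq.add_of_left hαd, ?_, ?_, ?_, ?_, ?_⟩
    · rw [natDegree_eq_of_degree_eq (degree_add_eq_left_of_degree_lt hrd), hhd]
    · rw [natDegree_eq_of_degree_eq (degree_add_eq_left_of_degree_lt hαd), hqd]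
    · rw [add_sub_right_comm]; exact add_mem hhc (hle hrmem)
    · rw [add_sub_right_comm]; exact add_mem hqc (hle hαmem)
    · have : g - (h + r) * (q + α) = ρ - r * α := by
        linear_combination (-1 : R[X]) * hαρ
      rw [this]
      have hrα : r * α ∈ 𝒥 ^ ((M + 1) + (M + 1)) := by
        rw [pow_add]; exact Ideal.mul_mem_mul hrmem hαmem
      exact sub_mem hρmem (Ideal.pow_le_pow_right (by lia) hrα)

/-- Uniqueness of Hensel lifts of a coprime factorization into monic polynomials. -/
theorem sub_mem_pow_of_mul_sub_mul_mem_pow (J : Ideal R) {h q h' q' u v : R[X]} (hh : h.Monic)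
    (hh' : h'.Monic) (hdeg : h'.natDegree = h.natDegree)
    (hqc : q' - q ∈ J.map (C : R →+* R[X]))
    (huv : u * h + v * q - 1 ∈ J.map (C : R →+* R[X])) {M : ℕ}
    (hM : h' * q' - h * q ∈ (J ^ M).map (C : R →+* R[X])) :
    h' - h ∈ (J ^ M).map (C : R →+* R[X]) ∧ q' - q ∈ (J ^ M).map (C : R →+* R[X]) := by
  nontriviality R
  have hrd : (h' - h).degree < h.degree := by
    have : h'.degree = h.degree := by
      rw [degree_eq_natDegree hh.ne_zero, degree_eq_natDegree hh'.ne_zero, hdeg]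
    rw [← this]
    exact degree_sub_lt_left this hh'.ne_zero (by rw [hh.leadingCoeff, hh'.leadingCoeff])
  suffices H : ∀ N ≤ M, h' - h ∈ (J ^ N).map (C : R →+* R[X]) ∧
      q' - q ∈ (J ^ N).map (C : R →+* R[X]) from H M le_rfl
  intro N hN
  induction N with
  | zero => simp [Ideal.one_eq_top, Ideal.map_top]
  | succ N ih =>
    obtain ⟨h1, h2⟩ := ih (by lia)
    have hM' := Ideal.map_mono (f := (C : R →+* R[X])) (Ideal.pow_le_pow_right hN) hM
    have hra : (h' - h) * (q' - q) ∈ (J ^ (N + 1)).map (C : R →+* R[X]) := by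
      rw [pow_succ, Ideal.map_mul]
      exact Ideal.mul_mem_mul h1 hqc
    have hr : h' - h ∈ (J ^ (N + 1)).map (C : R →+* R[X]) := by
      refine hh.mem_map_C_of_sub_mul_mem (s := (h' - h) * u - v * (q' - q)) hrd ?_
      have h3 : (h' - h) * (u * h + v * q - 1) ∈ (J ^ (N + 1)).map (C : R →+* R[X]) := by
        rw [pow_succ, Ideal.map_mul]
        exact Ideal.mul_mem_mul h1 huv
      have : (h' - h) - h * ((h' - h) * u - v * (q' - q)) =
        v * ((h' * q' - h * q) - (h' - h) * (q' - q)) - (h' - h) * (u * h + v * q - 1) := by ring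
      rw [this]
      exact sub_mem (Ideal.mul_mem_left _ _ (sub_mem hM' hra)) h3
    refine ⟨hr, hh.mem_map_C_of_mul_left_mem ?_⟩
    have : h * (q' - q) = (h' * q' - h * q) - (h' - h) * (q' - q) - (h' - h) * q := by ring
    rw [this]
    exact sub_mem (sub_mem hM' hra) (Ideal.mul_mem_right _ _ hr)

end Hensel

end Polynomial

/-- The finite van der Waerden theorem, with a bound that is uniform in the colouring. -/
theorem exists_bound_forall_exists_mono_progression (α : Type*) [Finite α] (L : ℕ) :
    ∃ W : ℕ, ∀ c : ℕ → α, ∃ u v : ℕ, 0 < v ∧ u + v * L ≤ W ∧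
      ∀ s < L, c (u + v * s) = c u := by
  classical
  obtain ⟨ι, _, hι⟩ := Combinatorics.Line.exists_mono_in_high_dimension (Fin (L + 1)) α
  refine ⟨Fintype.card ι * L, fun c => ?_⟩
  obtain ⟨l, b, hl⟩ := hι fun v => c (∑ i, (v i : ℕ))
  set S : Finset ι := {i | l.idxFun i = none} with hS
  set u : ℕ := ∑ i ∈ Sᶜ, (l 0 i : ℕ) with hu
  have key : ∀ s : Fin (L + 1), ∑ i, (l s i : ℕ) = u + S.card * s := by
    intro s
    rw [← Finset.sum_add_sum_compl S, add_comm]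
    congr 1
    · refine Finset.sum_congr rfl fun i hi => ?_
      rw [hS, Finset.compl_filter, Finset.mem_filter] at hi
      obtain ⟨y, hy⟩ := Option.ne_none_iff_exists'.mp hi.2
      rw [l.apply_some hy, l.apply_some hy]
    · rw [Finset.sum_congr rfl (g := fun _ => (s : ℕ)), Finset.sum_const, smul_eq_mul]
      intro i hi
      rw [hS, Finset.mem_filter] at hi
      rw [l.apply_none _ _ hi.2]
  have hcol : ∀ s : Fin (L + 1), c (u + S.card * s) = b := fun s => by rw [← key, ← hl s]
  refine ⟨u, S.card, Finset.card_pos.2 ⟨l.proper.choose, ?_⟩, ?_, fun s hs => ?_⟩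
  · rw [hS, Finset.mem_filter]
    exact ⟨Finset.mem_univ _, l.proper.choose_spec⟩
  · have := key (Fin.last L)
    rw [Fin.val_last] at this
    rw [← this]
    refine (Finset.sum_le_card_nsmul _ _ L fun i _ => ?_).trans (by simp)
    exact Nat.lt_succ_iff.1 (l (Fin.last L) i).isLt
  · have h0 := hcol 0
    have h1 := hcol ⟨s, by lia⟩
    simp only [Fin.val_zero, mul_zero, add_zero] at h0
    rw [h0]; exact h1

section House

open NumberField
open scoped Polynomial

variable {k : Type*} [Field k] [NumberField k]

theorem eq_zero_of_natCast_dvd_of_house_lt {N : ℕ} {y : 𝓞 k} (hN : (N : 𝓞 k) ∣ y)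
    (hy : house (algebraMap (𝓞 k) k y) < N) : y = 0 := by
  by_contra h0
  obtain ⟨z, rfl⟩ := hN
  have hz : algebraMap (𝓞 k) k z ≠ 0 := by
    rintro hz
    exact h0 (by rw [(map_eq_zero_iff _ (FaithfulSMul.algebraMap_injective (𝓞 k) k)).1 hz, mul_zero])
  have h1 := one_le_house_of_isIntegral z.isIntegral_coe hz
  rw [map_mul, map_natCast, house_nat_mul] at hy
  nlinarith [(Nat.cast_nonneg N : (0:ℝ) ≤ N)]

theorem house_le_of_forall_norm_le {x : k} {B : ℝ} (h : ∀ σ : k →+* ℂ, ‖σ x‖ ≤ B) :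
    house x ≤ B := by
  obtain ⟨σ, -, hσ⟩ := Finset.exists_mem_eq_sup' Finset.univ_nonempty
    (fun φ : k →+* ℂ ↦ ‖φ x‖₊)
  rw [house_eq_sup', hσ]
  exact h σ

theorem house_eval_natCast_le (a : (𝓞 k)[X]) (i : ℕ) :
    house (algebraMap (𝓞 k) k (a.eval (i : 𝓞 k))) ≤
      (∑ c ∈ Finset.range (a.natDegree + 1), house (algebraMap (𝓞 k) k (a.coeff c))) * (1 + i) ^ a.natDegree := by
  rw [Polynomial.eval_eq_sum_range, map_sum, Finset.sum_mul]
  refine (house_sum_le_sum_house _ _).trans (Finset.sum_le_sum fun c hc => ?_)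
  rw [map_mul, map_pow, map_natCast, mul_comm, ← Nat.cast_pow, house_nat_mul, mul_comm]
  refine mul_le_mul_of_nonneg_left ?_ (house_nonneg _)
  push_cast
  calc (i : ℝ) ^ c ≤ (1 + i) ^ c := by gcongr; linarith
    _ ≤ _ := pow_le_pow_right₀ (by simp) (by simpa [Nat.lt_succ_iff] using hc)

theorem exists_house_coeff_le (g : (𝓞 k)[X][X]) (hg : g.Monic) :
    ∃ (B : ℝ) (r : ℕ), 0 ≤ B ∧ ∀ (i : ℕ) (h q : (𝓞 k)[X]), h.Monic → q.Monic →
      h * q = g.map (Polynomial.evalRingHom (i : 𝓞 k)) →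
      ∀ c, house (algebraMap (𝓞 k) k (h.coeff c)) ≤ B * (1 + i) ^ r := by
  set D := g.natDegree with hD
  set E := (Finset.range D).sup fun c => (g.coeff c).natDegree
  set B₀ : ℝ := ∑ c ∈ Finset.range D,
    ∑ b ∈ Finset.range ((g.coeff c).natDegree + 1), house (algebraMap (𝓞 k) k ((g.coeff c).coeff b))
  have hB₀ : 0 ≤ B₀ := Finset.sum_nonneg fun _ _ => Finset.sum_nonneg fun _ _ => house_nonneg _
  refine ⟨(B₀ + 1) ^ D * D.choose (D / 2), E * D, by positivity, fun i h q hh hq hgi c => ?_⟩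
  set gi := g.map (Polynomial.evalRingHom (i : 𝓞 k)) with hgi_def
  have hgim : gi.Monic := hg.map _
  have hgid : gi.natDegree = D := hg.natDegree_map _
  set T : ℝ := (B₀ + 1) * (1 + i) ^ E with hT
  have hpow1 : (1 : ℝ) ≤ (1 + i) ^ E := one_le_pow₀ (by simp)
  have hT1 : 1 ≤ T := by nlinarith
  have hco : ∀ c < D, house (algebraMap (𝓞 k) k (gi.coeff c)) ≤ B₀ * (1 + i) ^ E := by
    intro c hc
    rw [hgi_def, Polynomial.coeff_map, Polynomial.coe_evalRingHom]
    refine (house_eval_natCast_le _ _).trans ?_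
    have h1 : (g.coeff c).natDegree ≤ E :=
      Finset.le_sup (f := fun c => (g.coeff c).natDegree) (Finset.mem_range.2 hc)
    have h2 : ∑ b ∈ Finset.range ((g.coeff c).natDegree + 1),
        house (algebraMap (𝓞 k) k ((g.coeff c).coeff b)) ≤ B₀ :=
      Finset.single_le_sum (f := fun c => ∑ b ∈ Finset.range ((g.coeff c).natDegree + 1),
        house (algebraMap (𝓞 k) k ((g.coeff c).coeff b)))
        (fun _ _ => Finset.sum_nonneg fun _ _ => house_nonneg _) (Finset.mem_range.2 hc)
    exact mul_le_mul h2 (pow_le_pow_right₀ (by simp) h1) (by positivity) hB₀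
  have hσ : ∀ σ : k →+* ℂ, ‖σ (algebraMap (𝓞 k) k (h.coeff c))‖ ≤ T ^ D * D.choose (D / 2) := by
    intro σ
    set τ : 𝓞 k →+* ℂ := σ.comp (algebraMap (𝓞 k) k)
    have hb := Polynomial.coeff_bdd_of_roots_le (B := T) (d := D) τ hh
      (IsAlgClosed.splits _) (by rw [← hgid, ← hgi, hh.natDegree_mul hq]; lia) ?_ c
    · rw [max_eq_left hT1, Polynomial.coeff_map] at hb
      exact hb
    intro z hz
    have hroot : (gi.map τ).IsRoot z := by
      rw [← hgi, Polynomial.map_mul, Polynomial.IsRoot.def, Polynomial.eval_mul,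
        (Polynomial.isRoot_of_mem_roots hz).eq_zero, zero_mul]
    have hlt := hroot.norm_lt_cauchyBound (hgim.map τ).ne_zero
    refine (show ‖z‖ ≤ (Polynomial.cauchyBound (gi.map τ) : ℝ) from mod_cast hlt.le).trans ?_
    rw [Polynomial.cauchyBound, (hgim.map τ).leadingCoeff, hgim.natDegree_map τ, hgid]
    have h3 : (((Finset.range D).sup fun c => ‖(gi.map τ).coeff c‖₊ : NNReal) : ℝ) ≤
        B₀ * (1 + i) ^ E := by
      rw [← Real.le_toNNReal_iff_coe_le (by positivity)]
      refine Finset.sup_le fun c hc => ?_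
      rw [Polynomial.coeff_map, Real.le_toNNReal_iff_coe_le (by positivity)]
      exact (norm_embedding_le_house _ σ).trans (hco c (Finset.mem_range.1 hc))
    simp only [nnnorm_one, div_one, NNReal.coe_add, NNReal.coe_one]
    nlinarith
  refine house_le_of_forall_norm_le fun σ => (hσ σ).trans (le_of_eq ?_)
  rw [hT, mul_pow, pow_mul]
  ring

end House

namespace Polynomial
open scoped Polynomial

/-- A monic polynomial over `A[X]` which is irreducible over `k[X]` has nonzero discriminant. -/
theorem exists_mul_add_mul_derivative_eq_C {A k : Type*} [CommRing A] [Field k] [CharZero k]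
    (φ : A →+* k) (hφ : Function.Injective φ) {g : A[X][X]} (hg : g.Monic)
    (hirr : Irreducible (g.map (mapRingHom φ))) :
    ∃ (U V : A[X][X]) (d : A[X]), d ≠ 0 ∧ U * g + V * derivative g = C d := by
  have : Nontrivial A := φ.domain_nontrivial
  let K := FractionRing k[X]
  let ψ : A[X] →+* K := (algebraMap k[X] K).comp (mapRingHom φ)
  have hψ : Function.Injective ψ :=
    (IsFractionRing.injective k[X] K).comp (map_injective φ hφ)
  have hK : Irreducible (g.map ψ) := by
    rw [← map_map]
    exact ((hg.map _).irreducible_iff_irreducible_map_fraction_map).1 hirr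
  have : CharZero K := charZero_of_injective_algebraMap (FaithfulSMul.algebraMap_injective k K)
  have hsep : IsCoprime (g.map ψ) (derivative (g.map ψ)) := hK.separable
  have hdeg : g.natDegree ≠ 0 := fun h0 => hirr.not_isUnit (by
    rw [eq_one_of_monic_natDegree_zero hg h0, Polynomial.map_one]; exact isUnit_one)
  obtain ⟨p, q, -, -, h⟩ := exists_mul_add_mul_eq_C_resultant g (derivative g)
    le_rfl le_rfl (Or.inl hdeg)
  refine ⟨p, q, _, fun h0 => ?_, by rw [← h]; ring⟩
  have h1 : resultant (g.map ψ) (derivative (g.map ψ)) = 0 := by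
    have h2 := resultant_map_map g (derivative g) g.natDegree (derivative g).natDegree ψ
    rw [h0, map_zero, ← derivative_map] at h2
    rwa [natDegree_map_eq_of_injective hψ, derivative_map, natDegree_map_eq_of_injective hψ,
      ← derivative_map]
  exact (resultant_eq_zero_iff.1 h1).2 hsep

end Polynomial

namespace Polynomial
open scoped Polynomial
open NumberField

theorem pow_dvd_fwdDiff_iter {R : Type*} [CommRing R] (Φ : R[X]) (c u v : R) {m κ : ℕ}
    (hκ : m ≤ κ) (e : ℕ → R)
    (he : ∀ s ≤ κ, c ^ m ∣ e s - Φ.eval (c * (u + v * s))) :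
    c ^ m ∣ (fwdDiff 1)^[κ] e 0 := by
  nontriviality R
  obtain rfl | hm := eq_or_ne m 0
  · simp
  set l : R[X] := C c * (C u + C v * X) with hl
  set P : R[X] := (Φ %ₘ X ^ m).comp l with hP
  have hPd : P.natDegree < κ := by
    have h1 : (Φ %ₘ X ^ m).natDegree < m := by
      have := natDegree_modByMonic_lt Φ (monic_X_pow (R := R) m) (by
        intro h; exact hm (by simpa using congrArg natDegree h))
      simpa using this
    have h2 : l.natDegree ≤ 1 := by
      rw [hl]; compute_degree
    refine (natDegree_comp_le.trans ?_).trans_lt (h1.trans_le hκ)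
    nlinarith
  have hstep : ∀ s ≤ κ, c ^ m ∣ e s - P.eval (s : R) := by
    intro s hs
    have h1 : Φ.eval (c * (u + v * s)) =
        P.eval (s : R) + (c * (u + v * s)) ^ m * (Φ /ₘ X ^ m).eval (c * (u + v * s)) := by
      conv_lhs => rw [← modByMonic_add_div Φ (X ^ m)]
      simp [hP, hl, eval_comp]
    have h2 := he s hs
    rw [h1, ← sub_sub] at h2
    refine (dvd_sub_left ?_).1 h2
    rw [mul_pow, mul_assoc]
    exact dvd_mul_right _ _
  have h0 : (fwdDiff 1)^[κ] P.eval (0 : R) = 0 := by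
    rw [fwdDiff_iter_eq_zero_of_degree_lt hPd]; rfl
  have : (fwdDiff 1)^[κ] e 0 = (fwdDiff 1)^[κ] e 0 - (fwdDiff 1)^[κ] P.eval (0 : R) := by
    rw [h0, sub_zero]
  rw [this, fwdDiff_iter_eq_sum_shift, fwdDiff_iter_eq_sum_shift, ← Finset.sum_sub_distrib]
  refine Finset.dvd_sum fun s hs => ?_
  rw [← smul_sub, zsmul_eq_mul]
  refine Dvd.dvd.mul_left ?_ _
  simpa using hstep s (by simpa [Nat.lt_succ_iff] using hs)

theorem house_fwdDiff_iter_le {k : Type*} [Field k] [NumberField k] (e : ℕ → k) {B : ℝ} {κ : ℕ}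
    (he : ∀ s ≤ κ, house (e s) ≤ B) : house ((fwdDiff 1)^[κ] e 0) ≤ 2 ^ κ * B := by
  rw [fwdDiff_iter_eq_sum_shift]
  refine (house_sum_le_sum_house _ _).trans ?_
  have h2 : (2 : ℝ) ^ κ = ∑ s ∈ Finset.range (κ + 1), (κ.choose s : ℝ) := by
    rw [← Nat.cast_sum, Nat.sum_range_choose]; simp
  rw [h2, Finset.sum_mul]
  refine Finset.sum_le_sum fun s hs => ?_
  rw [zsmul_eq_mul]
  refine (house_mul_le _ _).trans ?_
  have hB := he s (by simpa [Nat.lt_succ_iff] using hs)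
  rw [house_intCast]
  simp only [abs_mul, abs_pow, abs_neg, abs_one, one_pow, one_mul, Nat.abs_cast, zero_add,
    smul_eq_mul, mul_one, Int.cast_natCast]
  gcongr

theorem exists_natDegree_le_eval_natCast_eq {K : Type*} [Field K] [CharZero K] (e : ℕ → K)
    {m L : ℕ} (he : ∀ κ, m ≤ κ → κ < L → (fwdDiff 1)^[κ] e 0 = 0) :
    ∃ P : K[X], P.natDegree ≤ m ∧ ∀ s < L, P.eval (s : K) = e s := by
  refine ⟨∑ κ ∈ Finset.range m, C ((fwdDiff 1)^[κ] e 0 * (κ.factorial : K)⁻¹) *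
    descPochhammer K κ, ?_, fun s hs => ?_⟩
  · refine natDegree_sum_le_of_forall_le _ _ fun κ hκ => (natDegree_C_mul_le _ _).trans ?_
    rw [descPochhammer_natDegree]
    exact (Finset.mem_range.1 hκ).le
  · have h1 := shift_eq_sum_fwdDiff_iter 1 e s 0
    simp only [smul_eq_mul, mul_one, zero_add] at h1
    have hterm : ∀ κ, eval (s : K) (C ((fwdDiff 1)^[κ] e 0 * (κ.factorial : K)⁻¹) *
        descPochhammer K κ) = s.choose κ • (fwdDiff 1)^[κ] e 0 := by
      intro κ
      have hf : (κ.factorial : K) ≠ 0 := by exact_mod_cast κ.factorial_ne_zero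
      rw [eval_mul, eval_C, descPochhammer_eval_eq_descFactorial, Nat.descFactorial_eq_factorial_mul_choose,
        nsmul_eq_mul]
      push_cast
      field_simp
    rw [h1, eval_finsetSum]
    simp only [hterm]
    have hz1 : ∀ κ, s < κ → s.choose κ • (fwdDiff 1)^[κ] e 0 = 0 := fun κ hκ => by
      rw [Nat.choose_eq_zero_of_lt hκ, zero_smul]
    have hz2 : ∀ κ, m ≤ κ → s.choose κ • (fwdDiff 1)^[κ] e 0 = 0 := fun κ hκ => by
      obtain h | h := lt_or_ge κ L
      · rw [he κ hκ h, smul_zero]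
      · exact hz1 κ (by lia)
    obtain h | h := le_total m (s + 1)
    · exact Finset.sum_subset (Finset.range_subset_range.2 h) fun κ _ hκ =>
        hz2 κ (by simpa using hκ)
    · symm
      exact Finset.sum_subset (Finset.range_subset_range.2 h) fun κ _ hκ =>
        hz1 κ (by have := Finset.mem_range.not.1 hκ; lia)

theorem exists_natDegree_le_eval_eq_of_small {k : Type*} [Field k] [NumberField k]
    (e : ℕ → 𝓞 k) (Φ : (𝓞 k)[X]) {N m L : ℕ} {B : ℝ} (u v : 𝓞 k)
    (he : ∀ s < L, (N : 𝓞 k) ^ m ∣ e s - Φ.eval ((N : 𝓞 k) * (u + v * s)))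
    (hB : ∀ s < L, house (algebraMap (𝓞 k) k (e s)) ≤ B) (hN : 2 ^ L * B < N ^ m) :
    ∃ P : k[X], P.natDegree ≤ m ∧ ∀ s < L, P.eval (s : k) = algebraMap (𝓞 k) k (e s) := by
  refine exists_natDegree_le_eval_natCast_eq (fun s => algebraMap (𝓞 k) k (e s)) fun κ hmκ hκ => ?_
  have hmap : (fwdDiff 1)^[κ] (fun s => algebraMap (𝓞 k) k (e s)) 0 =
      algebraMap (𝓞 k) k ((fwdDiff 1)^[κ] e 0) := by
    simp only [fwdDiff_iter_eq_sum_shift, map_sum, map_zsmul]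
  rw [hmap, map_eq_zero_iff _ (FaithfulSMul.algebraMap_injective (𝓞 k) k)]
  have h1 := pow_dvd_fwdDiff_iter Φ (N : 𝓞 k) u v hmκ e fun s hs => he s (by lia)
  have h2 := house_fwdDiff_iter_le (fun s => algebraMap (𝓞 k) k (e s)) (κ := κ)
    fun s hs => hB s (by lia)
  have hB0 : 0 ≤ B := (house_nonneg _).trans (hB κ hκ)
  refine eq_zero_of_natCast_dvd_of_house_lt (N := N ^ m) (by exact_mod_cast h1) ?_
  rw [← hmap]
  push_cast
  refine (h2.trans ?_).trans_lt hN
  gcongr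
  norm_num

end Polynomial

namespace Polynomial
open scoped Polynomial

theorem map_mem_map_C_of_map_le {R S : Type*} [CommRing R] [CommRing S] {φ : R →+* S}
    {I : Ideal R} {J : Ideal S} (hIJ : I.map φ ≤ J) {f : R[X]} (hf : f ∈ I.map (C : R →+* R[X])) :
    f.map φ ∈ J.map (C : S →+* S[X]) := by
  rw [Ideal.mem_map_C_iff] at hf ⊢
  intro n
  rw [coeff_map]
  exact hIJ (Ideal.mem_map_of_mem φ (hf n))

/-- If the specializations of `g` at points that agree modulo `p` factor compatibly, and the
discriminant is a unit modulo `p`, then the coefficients of the factors are polynomials in the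
specialization point, modulo any power of `p`. -/
theorem exists_pow_dvd_coeff_sub_eval {A ι : Type*} [CommRing A] {g : A[X][X]} (hg : g.Monic)
    (a p w : A) (h q : ι → A[X]) (x : ι → A) (o : ι) (hx : ∀ s, p ∣ x s)
    (hh : ∀ s, (h s).Monic) (hq : ∀ s, (q s).Monic)
    (hmul : ∀ s, h s * q s = g.map (evalRingHom (a + x s)))
    (hdeg : ∀ s, (h s).natDegree = (h o).natDegree)
    (hho : ∀ s c, p ∣ (h s).coeff c - (h o).coeff c)
    (hqo : ∀ s c, p ∣ (q s).coeff c - (q o).coeff c)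
    {U V : A[X][X]} {d : A[X]} (hUV : U * g + V * derivative g = C d)
    (hw : p ∣ w * d.eval a - 1) (M : ℕ) :
    ∃ H Q : A[X][X], ∀ s c, p ^ M ∣ (h s).coeff c - (H.coeff c).eval (x s) ∧
      p ^ M ∣ (q s).coeff c - (Q.coeff c).eval (x s) := by
  nontriviality A
  set I : Ideal A := Ideal.span {p} with hI
  have hdvd : ∀ y, p ∣ y ↔ y ∈ I := fun y => Ideal.mem_span_singleton.symm
  have hho' : ∀ s, h s - h o ∈ I.map (C : A →+* A[X]) := fun s => by
    rw [Ideal.mem_map_C_iff]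
    intro c; rw [coeff_sub, ← hdvd]; exact hho s c
  have hqo' : ∀ s, q s - q o ∈ I.map (C : A →+* A[X]) := fun s => by
    rw [Ideal.mem_map_C_iff]
    intro c; rw [coeff_sub, ← hdvd]; exact hqo s c
  obtain ⟨u, v, huv⟩ : ∃ u v : A[X], u * h o + v * q o - 1 ∈ I.map (C : A →+* A[X]) := by
    set ε := evalRingHom (a + x o)
    refine ⟨C w * (U.map ε * q o + V.map ε * derivative (q o)),
      C w * V.map ε * derivative (h o), ?_⟩
    have h1 := congrArg (Polynomial.map ε) hUV
    rw [Polynomial.map_add, Polynomial.map_mul, Polynomial.map_mul, ← derivative_map, ← hmul,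
      derivative_mul, map_C, coe_evalRingHom] at h1
    have h2 : C w * (U.map ε * q o + V.map ε * derivative (q o)) * h o +
        C w * V.map ε * derivative (h o) * q o - 1 = C (w * d.eval (a + x o) - 1) := by
      rw [map_sub, map_mul, ← h1, C_1]; ring
    rw [h2]
    refine Ideal.mem_map_of_mem C ((hdvd _).1 ?_)
    have h3 : w * d.eval (a + x o) - 1 =
      w * (d.eval (a + x o) - d.eval a) + (w * d.eval a - 1) := by ring
    rw [h3]
    refine dvd_add (Dvd.dvd.mul_left ((hx o).trans ?_) _) hw
    simpa using sub_dvd_eval_sub (a + x o) a d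
  have huv' : ∀ s, u * h s + v * q s - 1 ∈ I.map (C : A →+* A[X]) := fun s => by
    have h1 : u * h s + v * q s - 1 =
      (u * h o + v * q o - 1) + (u * (h s - h o) + v * (q s - q o)) := by ring
    rw [h1]
    exact add_mem huv (add_mem (Ideal.mul_mem_left _ _ (hho' s)) (Ideal.mul_mem_left _ _ (hqo' s)))
  set J : Ideal A[X] := Ideal.span {C p, X} with hJ
  have hIJ : I.map (C : A →+* A[X]) ≤ J := by
    rw [hI, Ideal.map_span, Set.image_singleton]
    exact Ideal.span_mono (by simp)
  have hJI : ∀ s, J.map (evalRingHom (x s)) ≤ I := fun s => by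
    rw [hJ, Ideal.map_span, Ideal.span_le]
    rintro _ ⟨y, hy | hy, rfl⟩
    · rw [hy]; simp [hI]
    · rw [Set.mem_singleton_iff.1 hy]; simpa [hI, Ideal.mem_span_singleton] using hx s
  set G : A[X][X] := g.map (compRingHom (X + C a)) with hG
  have hGm : G.Monic := hg.map _
  have hGs : ∀ s, G.map (evalRingHom (x s)) = h s * q s := fun s => by
    rw [hmul, hG, map_map]
    congr 1
    ext <;> simp [add_comm]
  have hG0 : G - (h o).map C * (q o).map C ∈ J.map (C : A[X] →+* A[X][X]) := by
    rw [← Polynomial.map_mul, hmul, Ideal.mem_map_C_iff]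
    intro c
    rw [coeff_sub, hG, map_map, coeff_map, coeff_map]
    have h1 := sub_dvd_eval_sub (X + C a) (C (a + x o)) ((g.coeff c).map C)
    have h2 : ((g.coeff c).map C).eval (X + C a) = compRingHom (X + C a) (g.coeff c) := by
      rw [coe_compRingHom_apply, comp, eval₂_eq_eval_map]
    have h3 : ((g.coeff c).map C).eval (C (a + x o)) =
        (C.comp (evalRingHom (a + x o))) (g.coeff c) := by
      rw [eval_map, eval₂_at_apply]; rfl
    rw [h2, h3] at h1
    refine J.mem_of_dvd h1 ?_
    have h4 : X + C a - C (a + x o) = X - C (x o) := by rw [C_add]; ring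
    rw [h4]
    exact sub_mem (Ideal.subset_span (by simp))
      (hIJ (Ideal.mem_map_of_mem C ((hdvd _).1 (hx o))))
  have huvJ : u.map C * (h o).map C + v.map C * (q o).map C - 1 ∈ J.map (C : A[X] →+* A[X][X]) := by
    have h1 := map_mem_map_C_of_map_le hIJ huv
    simpa using h1
  obtain ⟨H, Q, hH, hQ, hHd, hQd, hH0, hQ0, hGHQ⟩ := exists_monic_mul_sub_mem_pow J hGm
    ((hh o).map C) ((hq o).map C) (by
      rw [(hh o).natDegree_map, (hq o).natDegree_map, ← (hh o).natDegree_mul (hq o), hmul,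
        hg.natDegree_map, hg.natDegree_map]) hG0 huvJ M
  refine ⟨H, Q, fun s => ?_⟩
  set ε := evalRingHom (x s) with hε
  have hεC : ∀ f : A[X], (f.map C).map ε = f := fun f => by
    rw [map_map]
    convert Polynomial.map_id
    ext; simp [hε]
  have hHs : H.map ε - h o ∈ I.map (C : A →+* A[X]) := by
    have h1 := map_mem_map_C_of_map_le (hJI s) hH0
    rwa [Polynomial.map_sub, hεC] at h1
  have hQs : Q.map ε - q o ∈ I.map (C : A →+* A[X]) := by
    have h1 := map_mem_map_C_of_map_le (hJI s) hQ0
    rwa [Polynomial.map_sub, hεC] at h1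
  have hprod : H.map ε * Q.map ε - h s * q s ∈ (I ^ M).map (C : A →+* A[X]) := by
    have h1 : (J ^ (M + 1)).map ε ≤ I ^ M := by
      rw [Ideal.map_pow]
      exact (Ideal.pow_right_mono (hJI s) _).trans (Ideal.pow_le_pow_right (by lia))
    have h2 := map_mem_map_C_of_map_le h1 hGHQ
    rw [Polynomial.map_sub, hGs, Polynomial.map_mul] at h2
    rw [← neg_sub]
    exact neg_mem h2
  obtain ⟨h1, h2⟩ := sub_mem_pow_of_mul_sub_mul_mem_pow I (hh s) (hH.map ε)
    (by rw [hH.natDegree_map, hHd, (hh o).natDegree_map, hdeg s])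
    (by simpa using sub_mem hQs (hqo' s)) (huv' s) hprod
  rw [Ideal.mem_map_C_iff] at h1 h2
  rw [hI, Ideal.span_singleton_pow] at h1 h2
  intro c
  have h3 := Ideal.mem_span_singleton.1 (h1 c)
  have h4 := Ideal.mem_span_singleton.1 (h2 c)
  rw [coeff_sub, coeff_map, dvd_sub_comm] at h3 h4
  exact ⟨h3, h4⟩

theorem exists_monic_map_evalRingHom_eq {K : Type*} [Field K] (f : ℕ → K[X]) {e m L : ℕ}
    (hf : ∀ s < L, (f s).Monic ∧ (f s).natDegree = e)
    (hP : ∀ c, ∃ P : K[X], P.natDegree ≤ m ∧ ∀ s < L, P.eval (s : K) = (f s).coeff c) :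
    ∃ H : K[X][X], H.Monic ∧ H.natDegree = e ∧ (∀ c, (H.coeff c).natDegree ≤ m) ∧
      ∀ s < L, H.map (evalRingHom (s : K)) = f s := by
  choose P hPm hPe using hP
  set T : K[X][X] := ∑ c ∈ Finset.range e, C (P c) * X ^ c with hT
  have hTc : ∀ c, T.coeff c = if c < e then P c else 0 := fun c => by
    simp [hT, finsetSum_coeff, coeff_C_mul, coeff_X_pow]
  have hTd : T.degree < e := by
    rw [degree_lt_iff_coeff_zero]
    intro c hc
    rw [hTc, if_neg (by lia)]
  refine ⟨X ^ e + T, monic_X_pow_add hTd, ?_, fun c => ?_, fun s hs => ?_⟩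
  · rw [natDegree_add_eq_left_of_degree_lt (by rwa [degree_X_pow]), natDegree_X_pow]
  · rw [coeff_add, coeff_X_pow, hTc]
    split_ifs with h1 h2
    · lia
    · simp
    · simpa using hPm c
    · simp
  · ext c
    rw [coeff_map, coeff_add, coeff_X_pow, hTc, coe_evalRingHom]
    obtain ⟨hm, hd⟩ := hf s hs
    split_ifs with h1 h2 h2
    · lia
    · rw [h1, ← hd, hm.coeff_natDegree]; simp
    · simpa using hPe c s hs
    · rw [coeff_eq_zero_of_natDegree_lt (by lia)]; simp

end Polynomial

namespace Polynomial
open scoped Polynomial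
open NumberField

theorem exists_monic_mul_eq_of_interpolation {K : Type*} [Field K] [CharZero K] {G : K[X][X]}
    (f f' : ℕ → K[X]) {e e' m L E : ℕ} (hG : ∀ c, (G.coeff c).natDegree ≤ E)
    (hf : ∀ s < L, (f s).Monic ∧ (f s).natDegree = e)
    (hf' : ∀ s < L, (f' s).Monic ∧ (f' s).natDegree = e')
    (hP : ∀ c, ∃ P : K[X], P.natDegree ≤ m ∧ ∀ s < L, P.eval (s : K) = (f s).coeff c)
    (hP' : ∀ c, ∃ P : K[X], P.natDegree ≤ m ∧ ∀ s < L, P.eval (s : K) = (f' s).coeff c)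
    (hmul : ∀ s < L, f s * f' s = G.map (evalRingHom (s : K)))
    (hm : m + m < L) (hE : E < L) :
    ∃ H Q : K[X][X], H.Monic ∧ Q.Monic ∧ H.natDegree = e ∧ Q.natDegree = e' ∧ H * Q = G := by
  obtain ⟨H, hHm, hHd, hHc, hH⟩ := exists_monic_map_evalRingHom_eq f hf hP
  obtain ⟨Q, hQm, hQd, hQc, hQ⟩ := exists_monic_map_evalRingHom_eq f' hf' hP'
  refine ⟨H, Q, hHm, hQm, hHd, hQd, ?_⟩
  ext1 c
  refine eq_of_natDegree_lt_card_of_eval_eq _ _ (ι := Fin L) (f := fun s => ((s : ℕ) : K))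
    (fun s s' h => Fin.ext (Nat.cast_injective h)) (fun s => ?_) ?_
  · have h1 := congrArg (fun f => f.coeff c) (hmul s s.2)
    simp only [← hH s s.2, ← hQ s s.2, ← Polynomial.map_mul, coeff_map, coe_evalRingHom] at h1
    exact h1
  · rw [Fintype.card_fin]
    refine max_lt (lt_of_le_of_lt ?_ hm) ((hG c).trans_lt hE)
    rw [coeff_mul]
    exact natDegree_sum_le_of_forall_le _ _ fun b _ =>
      natDegree_mul_le.trans (add_le_add (hHc _) (hQc _))

theorem exists_natCast_dvd_mul_sub_one {k : Type*} [Field k] [NumberField k] {y : 𝓞 k}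
    (hy : y ≠ 0) : ∃ (p : ℕ) (w : 𝓞 k), 1 < p ∧ (p : 𝓞 k) ∣ w * y - 1 := by
  have hmem := Ideal.absNorm_mem (Ideal.span {y})
  obtain ⟨w, hw⟩ := Ideal.mem_span_singleton.1 hmem
  have h0 : Ideal.absNorm (Ideal.span {y}) ≠ 0 := by
    rw [ne_eq, Ideal.absNorm_eq_zero_iff, Ideal.span_singleton_eq_bot]; exact hy
  refine ⟨Ideal.absNorm (Ideal.span {y}) + 1, -w, by lia, -1, ?_⟩
  push_cast
  rw [hw]; ring

/-- A case of **Hilbert's irreducibility theorem**: a monic polynomial over `(𝓞 k)[X]` which is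
irreducible over `k[X]` stays irreducible under some specialization `X ↦ i` with `i` a natural
number. -/
theorem exists_nat_irreducible_map_eval {k : Type*} [Field k] [NumberField k]
    {g : (𝓞 k)[X][X]} (hg : g.Monic)
    (hirr : Irreducible (g.map (mapRingHom (algebraMap (𝓞 k) k)))) :
    ∃ i : ℕ, Irreducible (g.map (evalRingHom (i : 𝓞 k))) := by
  by_contra! hcon
  have hinj := FaithfulSMul.algebraMap_injective (𝓞 k) k
  obtain ⟨U, V, d, hd0, hUV⟩ := exists_mul_add_mul_derivative_eq_C _ hinj hg hirr
  have hdeg : g.natDegree ≠ 0 := fun h0 => hirr.not_isUnit (by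
    rw [eq_one_of_monic_natDegree_zero hg h0, Polynomial.map_one]; exact isUnit_one)
  have hfac : ∀ i : ℕ, ∃ h q : (𝓞 k)[X], h.Monic ∧ q.Monic ∧
      h * q = g.map (evalRingHom (i : 𝓞 k)) ∧ h.natDegree ≠ 0 ∧ q.natDegree ≠ 0 := by
    intro i
    have h1 := hcon i
    rw [(hg.map _).irreducible_iff_natDegree, not_and] at h1
    replace h1 := h1 fun h => hdeg (by
      rw [← hg.natDegree_map (evalRingHom (i : 𝓞 k)), h, natDegree_one])
    push Not at h1
    obtain ⟨h, q, hh, hq, hhq, h2, h3⟩ := h1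
    exact ⟨h, q, hh, hq, hhq, h2, h3⟩
  choose h q hh hq hmul hhd hqd using hfac
  obtain ⟨a, ha⟩ : ∃ a : ℕ, d.eval (a : 𝓞 k) ≠ 0 := by
    by_contra! hz
    exact hd0 (eq_zero_of_infinite_isRoot d ((Set.infinite_range_of_injective
      (Nat.cast_injective (R := 𝓞 k))).mono (by rintro _ ⟨n, rfl⟩; exact hz n)))
  obtain ⟨p, w, hp, hw⟩ := exists_natCast_dvd_mul_sub_one ha
  obtain ⟨B, r, hB0, hB⟩ := exists_house_coeff_le g hg
  set m := r + 1 with hm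
  set D := g.natDegree with hD
  set E := g.support.sup fun c => (g.coeff c).natDegree with hE
  have hEc : ∀ c, (g.coeff c).natDegree ≤ E := fun c => by
    by_cases hc : c ∈ g.support
    · exact Finset.le_sup (f := fun c => (g.coeff c).natDegree) hc
    · rw [notMem_support_iff.1 hc, natDegree_zero]; exact zero_le
  set L := m + m + E + 1 with hL
  have hhle : ∀ i, (h i).natDegree ≤ D ∧ (q i).natDegree ≤ D := fun i => by
    have h1 := congrArg natDegree (hmul i)
    rw [(hh i).natDegree_mul (hq i), hg.natDegree_map] at h1
    lia
  set I : Ideal (𝓞 k) := Ideal.span {(p : 𝓞 k)}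
  have : Finite (𝓞 k ⧸ I) := Ideal.finiteQuotientOfFreeOfNeBot I (by
    rw [ne_eq, Ideal.span_singleton_eq_bot]; exact_mod_cast (by lia : p ≠ 0))
  obtain ⟨W, hW⟩ := exists_bound_forall_exists_mono_progression
    (Fin (D + 1) × (Fin (D + 1) → 𝓞 k ⧸ I) × (Fin (D + 1) → 𝓞 k ⧸ I)) L
  obtain ⟨n, hn⟩ := pow_unbounded_of_one_lt (2 ^ L * (B * (1 + a + W) ^ r))
    (by exact_mod_cast hp : (1 : ℝ) < p)
  set N := p ^ (n + 1) with hN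
  have hN1 : 1 ≤ N := Nat.one_le_pow _ _ (by lia)
  obtain ⟨u, v, hv, huvW, hcol⟩ := hW fun j =>
    (⟨(h (a + N * j)).natDegree, Nat.lt_succ_iff.2 (hhle _).1⟩,
      fun c => Ideal.Quotient.mk I ((h (a + N * j)).coeff c),
      fun c => Ideal.Quotient.mk I ((q (a + N * j)).coeff c))
  simp only [Prod.mk.injEq, Fin.mk.injEq, _root_.funext_iff, Ideal.Quotient.mk_eq_mk_iff_sub_mem] at hcol
  set i : ℕ → ℕ := fun s => a + N * (u + v * s) with hi
  have hi0 : i 0 = a + N * u := by simp [hi]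
  have hdegs : ∀ s < L, (h (i s)).natDegree = (h (i 0)).natDegree := fun s hs => by
    rw [hi0]; exact (hcol s hs).1
  have hcongr : ∀ s < L, ∀ c, (p : 𝓞 k) ∣ (h (i s)).coeff c - (h (i 0)).coeff c ∧
      (p : 𝓞 k) ∣ (q (i s)).coeff c - (q (i 0)).coeff c := fun s hs c => by
    obtain hc | hc := lt_or_ge c (D + 1)
    · rw [hi0]
      exact ⟨Ideal.mem_span_singleton.1 ((hcol s hs).2.1 ⟨c, hc⟩),
        Ideal.mem_span_singleton.1 ((hcol s hs).2.2 ⟨c, hc⟩)⟩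
    · have h1 := hhle (i s)
      have h2 := hhle (i 0)
      rw [coeff_eq_zero_of_natDegree_lt (by lia), coeff_eq_zero_of_natDegree_lt (by lia),
        coeff_eq_zero_of_natDegree_lt (by lia), coeff_eq_zero_of_natDegree_lt (by lia)]
      simp
  have hicast : ∀ s, ((i s : ℕ) : 𝓞 k) = a + (N : 𝓞 k) * (u + v * s) := fun s => by
    simp [hi]
  obtain ⟨H, Q, hHQ⟩ := exists_pow_dvd_coeff_sub_eval hg (a : 𝓞 k) (p : 𝓞 k) w
    (fun s : Fin L => h (i s)) (fun s => q (i s))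
    (fun s => (N : 𝓞 k) * (u + v * ((s : ℕ) : 𝓞 k))) (⟨0, by lia⟩ : Fin L)
    (fun s => Dvd.dvd.mul_right (by rw [hN]; push_cast; exact dvd_pow_self _ (by lia)) _)
    (fun s => hh _) (fun s => hq _) (fun s => by rw [← hicast]; exact hmul _)
    (fun s => hdegs s s.2) (fun s c => (hcongr s s.2 c).1) (fun s c => (hcongr s s.2 c).2)
    hUV hw ((n + 1) * m)
  set B' : ℝ := B * ((1 + a + W) * N) ^ r with hB'
  have hsmall : 2 ^ L * B' < (N : ℝ) ^ m := by
    have hNr : (N : ℝ) = p ^ n * p := by rw [hN]; push_cast; ring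
    have hp1 : (1 : ℝ) < p := by exact_mod_cast hp
    have hpn : (p : ℝ) ^ n ≤ N := by
      rw [hNr]; exact le_mul_of_one_le_right (by positivity) hp1.le
    have h1 : (0 : ℝ) < (N : ℝ) ^ r := by positivity
    calc 2 ^ L * B' = 2 ^ L * (B * (1 + a + W) ^ r) * (N : ℝ) ^ r := by rw [hB', mul_pow]; ring
      _ < N * (N : ℝ) ^ r := by gcongr; exact hn.trans_le hpn
      _ = (N : ℝ) ^ m := by rw [hm, pow_succ, mul_comm]
  have hiB : ∀ s < L, B * (1 + (i s : ℕ)) ^ r ≤ B' := fun s hs => by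
    rw [hB']
    gcongr
    have h1 : u + v * s ≤ W := (by gcongr : u + v * s ≤ u + v * L).trans huvW
    have h2 : 1 + i s ≤ (1 + a + W) * N := by
      simp only [hi]
      nlinarith
    exact_mod_cast h2
  have hP : ∀ c, ∃ P : k[X], P.natDegree ≤ m ∧
      ∀ s < L, P.eval (s : k) = ((h (i s)).map (algebraMap (𝓞 k) k)).coeff c := fun c => by
    simp only [coeff_map]
    refine exists_natDegree_le_eval_eq_of_small (fun s => (h (i s)).coeff c) (H.coeff c) (N := N)
      (u : 𝓞 k) v (fun s hs => ?_)
      (fun s hs => (hB _ _ _ (hh _) (hq _) (hmul _) c).trans (hiB s hs)) hsmall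
    have h1 := (hHQ ⟨s, hs⟩ c).1
    rwa [pow_mul, ← Nat.cast_pow] at h1
  have hP' : ∀ c, ∃ P : k[X], P.natDegree ≤ m ∧
      ∀ s < L, P.eval (s : k) = ((q (i s)).map (algebraMap (𝓞 k) k)).coeff c := fun c => by
    simp only [coeff_map]
    refine exists_natDegree_le_eval_eq_of_small (fun s => (q (i s)).coeff c) (Q.coeff c) (N := N)
      (u : 𝓞 k) v (fun s hs => ?_)
      (fun s hs => (hB _ _ _ (hq _) (hh _) ((mul_comm _ _).trans (hmul _)) c).trans
        (hiB s hs)) hsmall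
    have h1 := (hHQ ⟨s, hs⟩ c).2
    rwa [pow_mul, ← Nat.cast_pow] at h1
  have hunit : ((N * v : ℕ) : k) ≠ 0 := by
    exact_mod_cast (Nat.mul_pos hN1 hv).ne'
  let _ : Invertible ((N * v : ℕ) : k) := invertibleOfNonzero hunit
  set σ := algEquivCMulXAddC ((N * v : ℕ) : k) ((a + N * u : ℕ) : k) with hσ
  set gk := g.map (mapRingHom (algebraMap (𝓞 k) k)) with hgk
  have hσirr : Irreducible (gk.map (σ.toRingEquiv : k[X] →+* k[X])) := by
    rw [← mapEquiv_apply]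
    exact (MulEquiv.irreducible_iff _).2 hirr
  have hσd : ∀ c, ((gk.map (σ.toRingEquiv : k[X] →+* k[X])).coeff c).natDegree ≤ E := fun c => by
    rw [coeff_map]
    change (σ (gk.coeff c)).natDegree ≤ E
    rw [hσ, algEquivCMulXAddC_apply, ← comp_eq_aeval, hgk, coeff_map, coe_mapRingHom]
    refine natDegree_comp_le.trans ?_
    have h1 : (C ((N * v : ℕ) : k) * X + C ((a + N * u : ℕ) : k)).natDegree ≤ 1 :=
      natDegree_linear_le
    have h2 : ((g.coeff c).map (algebraMap (𝓞 k) k)).natDegree ≤ E :=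
      natDegree_map_le.trans (hEc c)
    nlinarith
  have hσs : ∀ s < L, (h (i s)).map (algebraMap (𝓞 k) k) * (q (i s)).map (algebraMap (𝓞 k) k) =
      (gk.map (σ.toRingEquiv : k[X] →+* k[X])).map (evalRingHom (s : k)) := fun s _ => by
    rw [← Polynomial.map_mul, hmul, hgk, map_map, map_map, map_map]
    congr 1
    ext
    · simp [hσ]
    · simp [hσ, hi]; ring
  obtain ⟨H', Q', hH'm, hQ'm, hH'd, hQ'd, hH'Q'⟩ := exists_monic_mul_eq_of_interpolation
    (fun s => (h (i s)).map (algebraMap (𝓞 k) k)) (fun s => (q (i s)).map (algebraMap (𝓞 k) k))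
    (e := (h (i 0)).natDegree) (e' := (q (i 0)).natDegree) hσd
    (fun s hs => ⟨(hh _).map _, by rw [(hh _).natDegree_map, hdegs s hs]⟩)
    (fun s hs => ⟨(hq _).map _, by
      have h1 := congrArg natDegree (hmul (i s))
      have h2 := congrArg natDegree (hmul (i 0))
      rw [(hh _).natDegree_mul (hq _), hg.natDegree_map] at h1 h2
      rw [(hq _).natDegree_map]
      have := hdegs s hs
      lia⟩) hP hP' hσs (by lia) (by lia)
  obtain hu | hu := hσirr.isUnit_or_isUnit hH'Q'.symm
  · rw [hH'm.isUnit_iff.1 hu, natDegree_one] at hH'd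
    exact hhd _ hH'd.symm
  · rw [hQ'm.isUnit_iff.1 hu, natDegree_one] at hQ'd
    exact hqd _ hQ'd.symm

end Polynomial

namespace MvPolynomial

/-- Set to zero the first `j` variables. -/
def killFirst (R : Type*) [CommRing R] (n j : ℕ) :
    MvPolynomial (Fin n) R →ₐ[R] MvPolynomial (Fin n) R :=
  aeval fun i => if i.val < j then 0 else X i

theorem le_height_ker_killFirst {R : Type*} [CommRing R] [IsDomain R] (n : ℕ) :
    ∀ j ≤ n, (j : ℕ∞) ≤ (RingHom.ker (killFirst R n j)).height
  | 0, _ => by simp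
  | j + 1, hj => by
    have : (RingHom.ker (killFirst R n j)).IsPrime := RingHom.ker_isPrime _
    have : (RingHom.ker (killFirst R n (j + 1))).IsPrime := RingHom.ker_isPrime _
    have hcomp : (killFirst R n (j + 1)).comp (killFirst R n j) = killFirst R n (j + 1) := by
      ext1 i
      by_cases h : i.val < j
      · simpa [killFirst, h] using fun h2 : j < i.val => absurd h2 (by omega)
      · simp [killFirst, h]
    refine le_trans ?_ (Ideal.height_add_one_le_of_lt_of_isPrime
      (I := RingHom.ker (killFirst R n j)) ?_)
    · push_cast
      gcongr
      exact le_height_ker_killFirst n j (by omega)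
    · refine lt_of_le_of_ne (fun p hp => ?_) fun h => ?_
      · rw [RingHom.mem_ker] at hp ⊢
        rw [← hcomp, AlgHom.comp_apply, hp, map_zero]
      · have h1 : (X ⟨j, hj⟩ : MvPolynomial (Fin n) R) ∈ RingHom.ker (killFirst R n (j + 1)) := by
          simp [killFirst]
        rw [← h] at h1
        simp [killFirst] at h1

theorem le_height_vanishingIdeal_zero {k K : Type*} [Field k] [Field K] [Algebra k K] (n : ℕ) :
    (n : ℕ∞) ≤ (vanishingIdeal k {(0 : Fin n → K)} :
      Ideal (MvPolynomial (Fin n) k)).height := by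
  refine (le_height_ker_killFirst n n le_rfl).trans (Ideal.height_mono fun p hp => ?_)
  rw [mem_vanishingIdeal_singleton_iff]
  have h : (aeval (R := k) (0 : Fin n → K)).comp (killFirst k n n) = aeval (0 : Fin n → K) := by
    ext1 i
    simp [killFirst]
  rw [RingHom.mem_ker] at hp
  rw [← h, AlgHom.comp_apply, hp, map_zero]

/-- Fewer than `n` homogeneous polynomials of positive degree in `n` variables have a common
nontrivial zero over an algebraically closed field. -/
theorem exists_ne_zero_aeval_eq_zero {k K : Type*} [Field k] [Field K] [Algebra k K]
    [IsAlgClosed K] [Algebra.IsAlgebraic k K] {n : ℕ} (s : Finset (MvPolynomial (Fin n) k))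
    (hs : s.card < n) (hzero : ∀ p ∈ s, aeval (0 : Fin n → K) p = 0) :
    ∃ x : Fin n → K, x ≠ 0 ∧ ∀ p ∈ s, aeval x p = 0 := by
  by_contra! hcon
  have hlocus : zeroLocus K (Ideal.span (s : Set (MvPolynomial (Fin n) k))) = {0} := by
    ext x
    rw [zeroLocus_span]
    refine ⟨fun hx => ?_, ?_⟩
    · by_contra hx0
      obtain ⟨p, hp, h⟩ := hcon x hx0
      exact h (hx p hp)
    · rintro rfl
      exact hzero
  have hrad := vanishingIdeal_zeroLocus_eq_radical (K := K)
    (Ideal.span (s : Set (MvPolynomial (Fin n) k)))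
  rw [hlocus] at hrad
  have hmem : vanishingIdeal k {(0 : Fin n → K)} ∈
      (Ideal.span (s : Set (MvPolynomial (Fin n) k))).minimalPrimes := by
    rw [← Ideal.radical_minimalPrimes, ← hrad, Ideal.minimalPrimes_eq_subsingleton_self]
    rfl
  have := (le_height_vanishingIdeal_zero (k := k) (K := K) n).trans
    (Ideal.height_le_card_of_mem_minimalPrimes_span_finset hmem)
  exact absurd (Nat.cast_le.1 this) (by omega)

theorem homogeneousComponent_mul_totalDegree {σ R : Type*} [CommRing R] (A B : MvPolynomial σ R) :
    homogeneousComponent (A.totalDegree + B.totalDegree) (A * B) =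
      homogeneousComponent A.totalDegree A * homogeneousComponent B.totalDegree B := by
  classical
  ext d
  rw [coeff_homogeneousComponent]
  split_ifs with h
  · rw [coeff_mul, coeff_mul]
    refine Finset.sum_congr rfl fun x hx => ?_
    rw [coeff_homogeneousComponent, coeff_homogeneousComponent]
    have hdeg : x.1.degree + x.2.degree = A.totalDegree + B.totalDegree := by
      rw [← h, ← Finset.HasAntidiagonal.mem_antidiagonal.1 hx, map_add]
    have hA : A.totalDegree < x.1.degree → coeff x.1 A = 0 := fun h1 =>
      coeff_eq_zero_of_totalDegree_lt h1
    have hB : B.totalDegree < x.2.degree → coeff x.2 B = 0 := fun h1 =>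
      coeff_eq_zero_of_totalDegree_lt h1
    rcases lt_trichotomy x.1.degree A.totalDegree with h1 | h1 | h1
    · rw [hB (by omega)]
      simp [h1.ne]
    · rw [if_pos h1, if_pos (by omega)]
    · rw [hA h1]
      simp
  · refine (IsHomogeneous.coeff_eq_zero (n := A.totalDegree + B.totalDegree) ?_ h).symm
    exact (homogeneousComponent_isHomogeneous _ _).mul (homogeneousComponent_isHomogeneous _ _)

theorem aeval_zero_of_isHomogeneous {σ R S : Type*} [CommRing R] [CommRing S] [Algebra R S]
    {A : MvPolynomial σ R} {n : ℕ} (hA : A.IsHomogeneous n) (hn : n ≠ 0) :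
    aeval (0 : σ → S) A = 0 := by
  rw [aeval_zero, constantCoeff_eq, hA.coeff_eq_zero (by simpa using hn.symm), map_zero]

end MvPolynomial

open MvPolynomial in
theorem IsSmoothPlaneCurve.irreducible {k : Type} [Field k] {d : ℕ} (hd : 2 ≤ d)
    {F : MvPolynomial (Fin 3) k} (hF : IsSmoothPlaneCurve d F) : Irreducible F := by
  classical
  have hF0 : F ≠ 0 := by
    rintro rfl
    obtain ⟨i, hi⟩ := hF.2 1 one_ne_zero
    simp at hi
  have hdeg : F.totalDegree = d := hF.1.totalDegree hF0
  refine ⟨fun hu => ?_, fun A B hAB => ?_⟩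
  · have := MvPolynomial.isUnit_iff_totalDegree_of_isReduced.1 hu
    omega
  by_contra! hcon
  have hA0 : A ≠ 0 := by rintro rfl; simp [hF0] at hAB
  have hB0 : B ≠ 0 := by rintro rfl; simp [hF0] at hAB
  have hpos : ∀ Q : MvPolynomial (Fin 3) k, Q ≠ 0 → ¬ IsUnit Q → Q.totalDegree ≠ 0 := by
    intro Q hQ0 hQ h
    rw [totalDegree_eq_zero_iff_eq_C] at h
    refine hQ (h ▸ IsUnit.map C (isUnit_iff_ne_zero.2 fun h0 => hQ0 ?_))
    rw [h, h0, map_zero]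
  have hmul := homogeneousComponent_mul_totalDegree A B
  rw [← totalDegree_mul_of_isDomain hA0 hB0, ← hAB, hdeg,
    homogeneousComponent_eq_self hF.1] at hmul
  have hz : ∀ Q : MvPolynomial (Fin 3) k, Q ≠ 0 → ¬ IsUnit Q →
      aeval (0 : Fin 3 → AlgebraicClosure k) (homogeneousComponent Q.totalDegree Q) = 0 :=
    fun Q hQ0 hQ =>
      aeval_zero_of_isHomogeneous (homogeneousComponent_isHomogeneous _ _) (hpos Q hQ0 hQ)
  obtain ⟨x, hx0, hx⟩ := exists_ne_zero_aeval_eq_zero (K := AlgebraicClosure k)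
    {homogeneousComponent A.totalDegree A, homogeneousComponent B.totalDegree B}
    (Finset.card_le_two.trans_lt (by norm_num)) (by
      simp only [Finset.mem_insert, Finset.mem_singleton, forall_eq_or_imp, forall_eq]
      exact ⟨hz A hA0 hcon.1, hz B hB0 hcon.2⟩)
  simp only [Finset.mem_insert, Finset.mem_singleton, forall_eq_or_imp, forall_eq] at hx
  obtain ⟨i, hi⟩ := hF.2 x hx0
  refine hi ?_
  rw [eval_map, ← aeval_def, hmul, Derivation.leibniz, map_add, smul_eq_mul, smul_eq_mul,
    map_mul, map_mul, hx.1, hx.2, zero_mul, zero_mul, add_zero]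

namespace MvPolynomial

open scoped Polynomial

theorem IsHomogeneous.eval_mul {σ R : Type*} [Fintype σ] [CommRing R] {F : MvPolynomial σ R}
    {n : ℕ} (hF : F.IsHomogeneous n) (c : R) (u : σ → R) :
    eval (fun i => c * u i) F = c ^ n * eval u F := by
  rw [eval_eq', eval_eq', Finset.mul_sum]
  refine Finset.sum_congr rfl fun d hd => ?_
  have : ∑ i, d i = n := by
    rw [← Finsupp.degree_eq_sum]
    by_contra h
    exact mem_support_iff.1 hd (hF.coeff_eq_zero h)
  simp only [mul_pow, Finset.prod_mul_distrib, Finset.prod_pow_eq_pow_sum, this]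
  ring

theorem IsHomogeneous.eval_single {σ R : Type*} [Fintype σ] [DecidableEq σ] [CommRing R]
    {F : MvPolynomial σ R} {n : ℕ} (hF : F.IsHomogeneous n) (i : σ) :
    eval (Pi.single i 1) F = coeff (Finsupp.single i n) F := by
  rw [eval_eq', Finset.sum_eq_single (Finsupp.single i n)]
  · rw [Finset.prod_eq_one, mul_one]
    intro j _
    by_cases h : j = i
    · subst h; simp
    · simp [Ne.symm h]
  · intro d hd hne
    have hdeg : d.degree = n := by
      by_contra h
      exact mem_support_iff.1 hd (hF.coeff_eq_zero h)
    have : ∃ j, j ≠ i ∧ d j ≠ 0 := by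
      by_contra! hcon
      refine hne ?_
      have : d = Finsupp.single i (d i) := by
        ext j
        by_cases h : j = i
        · subst h; simp
        · rw [hcon j h, Finsupp.single_eq_of_ne h]
      rw [this, Finsupp.degree_single] at hdeg
      rw [this, hdeg]
    obtain ⟨j, hj, hdj⟩ := this
    rw [Finset.prod_eq_zero (Finset.mem_univ j), mul_zero]
    rw [Pi.single_eq_of_ne hj, zero_pow hdj]
  · intro h
    rw [notMem_support_iff.1 h, zero_mul]

/-- The substitution `X ↦ a x + b`, `Y ↦ 1`, `Z ↦ z`, with values in polynomials in `z` whose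
coefficients are polynomials in `x`. -/
def planeSubst {k : Type*} [Field k] (a b : k) : MvPolynomial (Fin 3) k →ₐ[k] k[X][X] :=
  aeval ![Polynomial.C (Polynomial.C b + Polynomial.C a * Polynomial.X), 1, Polynomial.X]

section planeSubst

variable {k : Type*} [Field k] {a b : k}

@[simp] theorem planeSubst_X_zero : planeSubst a b (X 0) =
    Polynomial.C (Polynomial.C b + Polynomial.C a * Polynomial.X) := by simp [planeSubst]

@[simp] theorem planeSubst_X_one : planeSubst a b (X 1) = 1 := by simp [planeSubst]

@[simp] theorem planeSubst_X_two : planeSubst a b (X 2) = Polynomial.X := by simp [planeSubst]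

@[simp] theorem planeSubst_C (c : k) :
    planeSubst a b (C c) = Polynomial.C (Polynomial.C c) := by
  rw [← algebraMap_eq, AlgHom.commutes]
  rfl

theorem eval₂_planeSubst {S : Type*} [CommRing S] [Algebra k S] (F : MvPolynomial (Fin 3) k)
    (x : k) (z : S) :
    Polynomial.eval₂ (algebraMap k S) z ((planeSubst a b F).map (Polynomial.evalRingHom x)) =
      aeval ![algebraMap k S (b + a * x), 1, z] F := by
  induction F using MvPolynomial.induction_on with
  | C c => simp
  | add p q hp hq =>
    rw [map_add, Polynomial.map_add, Polynomial.eval₂_add, hp, hq]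
    exact (map_add (aeval _) p q).symm
  | mul_X p i hp =>
    rw [map_mul, Polynomial.map_mul, Polynomial.eval₂_mul, hp, map_mul]
    fin_cases i <;> simp

theorem eq_zero_of_planeSubst_eq_zero [Infinite k] (ha : a ≠ 0) {F : MvPolynomial (Fin 3) k}
    {n : ℕ} (hF : F.IsHomogeneous n) (h : planeSubst a b F = 0) : F = 0 := by
  suffices h1 : F * X 1 = 0 from (mul_eq_zero.1 h1).resolve_right (X_ne_zero 1)
  refine MvPolynomial.funext fun u => ?_
  rw [map_mul, eval_X, map_zero]
  by_cases hu : u 1 = 0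
  · rw [hu, mul_zero]
  · have h2 := eval₂_planeSubst (a := a) (b := b) F ((u 0 / u 1 - b) / a) (u 2 / u 1)
    rw [h, Polynomial.map_zero, Polynomial.eval₂_zero] at h2
    have h3 : u = fun i => u 1 * (![algebraMap k k (b + a * ((u 0 / u 1 - b) / a)), 1,
        u 2 / u 1] : Fin 3 → k) i := by
      funext i
      fin_cases i
      · simp; field_simp; ring
      · simp
      · simp; field_simp
    rw [h3, hF.eval_mul, ← coe_aeval_eq_eval, RingHom.coe_coe, ← h2, mul_zero, zero_mul]

theorem exists_isHomogeneous_planeSubst_eq (ha : a ≠ 0) (H : k[X][X]) :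
    ∃ (n : ℕ) (h : MvPolynomial (Fin 3) k), h.IsHomogeneous n ∧ planeSubst a b h = H := by
  have hadd : ∀ H₁ H₂ : k[X][X],
      (∃ (n : ℕ) (h : MvPolynomial (Fin 3) k), h.IsHomogeneous n ∧ planeSubst a b h = H₁) →
      (∃ (n : ℕ) (h : MvPolynomial (Fin 3) k), h.IsHomogeneous n ∧ planeSubst a b h = H₂) →
      ∃ (n : ℕ) (h : MvPolynomial (Fin 3) k), h.IsHomogeneous n ∧ planeSubst a b h = H₁ + H₂ := by
    rintro _ _ ⟨n, h, hn, rfl⟩ ⟨m, h', hm, rfl⟩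
    refine ⟨n + m, h * X 1 ^ m + h' * X 1 ^ n,
      (hn.mul (isHomogeneous_X_pow 1 m)).add ?_, by simp⟩
    rw [add_comm]
    exact hm.mul (isHomogeneous_X_pow 1 n)
  have hmul : ∀ H₁ H₂ : k[X][X],
      (∃ (n : ℕ) (h : MvPolynomial (Fin 3) k), h.IsHomogeneous n ∧ planeSubst a b h = H₁) →
      (∃ (n : ℕ) (h : MvPolynomial (Fin 3) k), h.IsHomogeneous n ∧ planeSubst a b h = H₂) →
      ∃ (n : ℕ) (h : MvPolynomial (Fin 3) k), h.IsHomogeneous n ∧ planeSubst a b h = H₁ * H₂ := by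
    rintro _ _ ⟨n, h, hn, rfl⟩ ⟨m, h', hm, rfl⟩
    exact ⟨n + m, h * h', hn.mul hm, by simp⟩
  have hC : ∀ c : k, ∃ (n : ℕ) (h : MvPolynomial (Fin 3) k), h.IsHomogeneous n ∧
      planeSubst a b h = Polynomial.C (Polynomial.C c) :=
    fun c => ⟨0, C c, isHomogeneous_C _ c, by simp⟩
  have hx : ∃ (n : ℕ) (h : MvPolynomial (Fin 3) k), h.IsHomogeneous n ∧
      planeSubst a b h = Polynomial.C Polynomial.X := by
    refine ⟨1, C a⁻¹ * X 0 + C (-(a⁻¹ * b)) * X 1,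
      (isHomogeneous_C_mul_X _ _).add (isHomogeneous_C_mul_X _ _), ?_⟩
    simp only [map_add, map_mul, planeSubst_C, planeSubst_X_zero, planeSubst_X_one, mul_one,
      mul_add, map_neg]
    have h : (Polynomial.C (Polynomial.C a⁻¹) * Polynomial.C (Polynomial.C a) : k[X][X]) = 1 := by
      rw [← map_mul, ← map_mul, inv_mul_cancel₀ ha, map_one, map_one]
    linear_combination Polynomial.C Polynomial.X * h
  have hz : ∃ (n : ℕ) (h : MvPolynomial (Fin 3) k), h.IsHomogeneous n ∧
      planeSubst a b h = Polynomial.X := ⟨1, X 2, isHomogeneous_X _ 2, by simp⟩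
  have hcoef : ∀ p : k[X], ∃ (n : ℕ) (h : MvPolynomial (Fin 3) k), h.IsHomogeneous n ∧
      planeSubst a b h = Polynomial.C p := by
    intro p
    induction p using Polynomial.induction_on with
    | C c => exact hC c
    | add p q hp hq => rw [map_add]; exact hadd _ _ hp hq
    | monomial n c h =>
      rw [pow_succ, ← mul_assoc, map_mul]
      exact hmul _ _ h hx
  induction H using Polynomial.induction_on with
  | C p => exact hcoef p
  | add p q hp hq => exact hadd _ _ hp hq
  | monomial n c h =>
    rw [pow_succ, ← mul_assoc]
    exact hmul _ _ h hz

theorem prime_planeSubst [Infinite k] (ha : a ≠ 0) {F : MvPolynomial (Fin 3) k} {n : ℕ}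
    (hn : 2 ≤ n) (hF : F.IsHomogeneous n) (hirr : Irreducible F) : Prime (planeSubst a b F) := by
  have hF0 := hirr.ne_zero
  have hprime : Prime F := hirr.prime
  have hX : ∀ m, ¬ F ∣ X 1 ^ m := by
    intro m h
    obtain ⟨Q, hQ⟩ := hprime.dvd_of_dvd_pow h
    have hQ0 : Q ≠ 0 := by
      rintro rfl
      exact X_ne_zero (R := k) (1 : Fin 3) (by simp at hQ)
    have := congrArg totalDegree hQ
    rw [totalDegree_X, totalDegree_mul_of_isDomain hF0 hQ0, hF.totalDegree hF0] at this
    omega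
  have hinj : ∀ {p q : ℕ} {A B : MvPolynomial (Fin 3) k}, A.IsHomogeneous p → B.IsHomogeneous q →
      planeSubst a b A = planeSubst a b B → A * X 1 ^ q = B * X 1 ^ p := by
    intro p q A B hA hB hAB
    rw [← sub_eq_zero]
    refine eq_zero_of_planeSubst_eq_zero (a := a) (b := b) ha (n := p + q)
      ((hA.mul (isHomogeneous_X_pow 1 q)).sub ?_) (by simp [hAB])
    rw [add_comm]
    exact hB.mul (isHomogeneous_X_pow 1 p)
  have key : ∀ G : k[X][X], planeSubst a b F ∣ G → ∀ {p : ℕ} {A : MvPolynomial (Fin 3) k},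
      A.IsHomogeneous p → planeSubst a b A = G → ∃ m, F ∣ A * X 1 ^ m := by
    rintro _ ⟨Q, rfl⟩ p A hA hAQ
    obtain ⟨q, B, hB, rfl⟩ := exists_isHomogeneous_planeSubst_eq (b := b) ha Q
    rw [← map_mul] at hAQ
    exact ⟨_, B * X 1 ^ p, by rw [hinj hA (hF.mul hB) hAQ, mul_assoc]⟩
  refine ⟨fun h => hF0 (eq_zero_of_planeSubst_eq_zero ha hF h), fun h => ?_, fun G H hGH => ?_⟩
  · obtain ⟨m, hm⟩ := key 1 h.dvd (isHomogeneous_one (Fin 3) k) (map_one _)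
    exact hX m (by simpa using hm)
  · obtain ⟨p, A, hA, rfl⟩ := exists_isHomogeneous_planeSubst_eq (b := b) ha G
    obtain ⟨q, B, hB, rfl⟩ := exists_isHomogeneous_planeSubst_eq (b := b) ha H
    obtain ⟨m, hm⟩ := key _ hGH (hA.mul hB) (map_mul _ _ _)
    rcases hprime.dvd_or_dvd ((hprime.dvd_or_dvd hm).resolve_right (hX m)) with h | h
    · exact Or.inl (map_dvd _ h)
    · exact Or.inr (map_dvd _ h)

theorem coeff_planeSubst (F : MvPolynomial (Fin 3) k) (m : ℕ) :
    (planeSubst a b F).coeff m = ∑ d ∈ F.support, if d 2 = m then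
      Polynomial.C (coeff d F) * (Polynomial.C b + Polynomial.C a * Polynomial.X) ^ d 0 else 0 := by
  rw [planeSubst, aeval_def, eval₂_eq', Polynomial.finsetSum_coeff]
  refine Finset.sum_congr rfl fun d _ => ?_
  have : algebraMap k k[X][X] (coeff d F) = Polynomial.C (Polynomial.C (coeff d F)) := rfl
  simp only [this, Fin.prod_univ_three, Matrix.cons_val_zero, Matrix.cons_val_one,
    Matrix.cons_val, one_pow, mul_one]
  rw [← map_pow, ← mul_assoc, ← map_mul, Polynomial.coeff_C_mul_X_pow]
  simp only [eq_comm]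

theorem IsHomogeneous.coeff_planeSubst_self {F : MvPolynomial (Fin 3) k} {n : ℕ}
    (hF : F.IsHomogeneous n) :
    (planeSubst a b F).coeff n = Polynomial.C (coeff (Finsupp.single 2 n) F) := by
  classical
  rw [coeff_planeSubst, ← Finset.sum_singleton (fun d => Polynomial.C (coeff d F))]
  refine Finset.sum_congr_of_eq_on_inter (fun d hd hd' => ?_) (fun d _ hd' => ?_) fun d _ hd' => ?_
  · refine if_neg fun h => hd' ?_
    have hdeg : d.degree = n := by
      by_contra h
      exact mem_support_iff.1 hd (hF.coeff_eq_zero h)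
    rw [Finsupp.degree_eq_sum, Fin.sum_univ_three] at hdeg
    rw [Finset.mem_singleton]
    ext i
    fin_cases i <;> simp <;> omega
  · rw [notMem_support_iff.1 hd', map_zero]
  · rw [Finset.mem_singleton] at hd'
    subst hd'
    simp

theorem IsHomogeneous.coeff_planeSubst {F : MvPolynomial (Fin 3) k} {n : ℕ}
    (hF : F.IsHomogeneous (n + 1)) :
    (planeSubst a b F).coeff n =
      Polynomial.C (coeff (Finsupp.single 2 n + Finsupp.single 0 1) F) *
        (Polynomial.C b + Polynomial.C a * Polynomial.X) +
      Polynomial.C (coeff (Finsupp.single 2 n + Finsupp.single 1 1) F) := by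
  classical
  have hne : (Finsupp.single 2 n + Finsupp.single 0 1 : Fin 3 →₀ ℕ) ≠
      Finsupp.single 2 n + Finsupp.single 1 1 := by
    intro h
    simpa using DFunLike.congr_fun h 0
  have hsum : ∑ d ∈ ({Finsupp.single 2 n + Finsupp.single 0 1,
        Finsupp.single 2 n + Finsupp.single 1 1} : Finset (Fin 3 →₀ ℕ)),
      Polynomial.C (coeff d F) * (Polynomial.C b + Polynomial.C a * Polynomial.X) ^ d 0 =
      Polynomial.C (coeff (Finsupp.single 2 n + Finsupp.single 0 1) F) *
        (Polynomial.C b + Polynomial.C a * Polynomial.X) +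
      Polynomial.C (coeff (Finsupp.single 2 n + Finsupp.single 1 1) F) := by
    rw [Finset.sum_pair hne]
    simp
  rw [MvPolynomial.coeff_planeSubst, ← hsum]
  refine Finset.sum_congr_of_eq_on_inter (fun d hd hd' => ?_) (fun d _ hd' => ?_) fun d _ hd' => ?_
  · refine if_neg fun h => hd' ?_
    have hdeg : d.degree = n + 1 := by
      by_contra h
      exact mem_support_iff.1 hd (hF.coeff_eq_zero h)
    rw [Finsupp.degree_eq_sum, Fin.sum_univ_three] at hdeg
    rw [Finset.mem_insert, Finset.mem_singleton]
    rcases Nat.eq_zero_or_pos (d 0) with h0 | h0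
    · right
      ext i
      fin_cases i <;> simp <;> omega
    · left
      ext i
      fin_cases i <;> simp <;> omega
  · rw [notMem_support_iff.1 hd', map_zero, zero_mul]
  · rw [Finset.mem_insert, Finset.mem_singleton] at hd'
    rcases hd' with rfl | rfl <;> simp

end planeSubst

end MvPolynomial

open MvPolynomial in
theorem IsSmoothPlaneCurve.le_natDegree_planeSubst {k : Type} [Field k] {a b : k} (ha : a ≠ 0)
    {n : ℕ} {F : MvPolynomial (Fin 3) k} (hF : IsSmoothPlaneCurve (n + 1) F) :
    n ≤ (planeSubst a b F).natDegree := by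
  classical
  by_contra! hlt
  have h1 := hF.1.coeff_planeSubst_self (a := a) (b := b)
  have h2 := hF.1.coeff_planeSubst (a := a) (b := b)
  rw [Polynomial.coeff_eq_zero_of_natDegree_lt (by omega), eq_comm, Polynomial.C_eq_zero] at h1
  rw [Polynomial.coeff_eq_zero_of_natDegree_lt hlt] at h2
  have h3 := congrArg (Polynomial.coeff · 1) h2
  simp [ha] at h3
  rw [h3, map_zero, zero_mul, zero_add, eq_comm, Polynomial.C_eq_zero] at h2
  obtain ⟨i, hi⟩ := hF.2 (Pi.single 2 1) (by simp)
  refine hi ?_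
  have hhom : (pderiv i F).IsHomogeneous n := hF.1.pderiv
  rw [(hhom.map _).eval_single, coeff_map, coeff_pderiv]
  fin_cases i
  · simp [h3]
  · simp [h2]
  · simp [← Finsupp.single_add, h1]

namespace Polynomial
open scoped Polynomial
open NumberField

theorem integralNormalization_comp_C_leadingCoeff_mul_X {R : Type*} [CommRing R] {p : R[X]}
    (hp : 1 ≤ p.natDegree) :
    p.integralNormalization.comp (C p.leadingCoeff * X) =
      p * C (p.leadingCoeff ^ (p.natDegree - 1)) := by
  ext n
  rw [comp_C_mul_X_coeff, integralNormalization_coeff_mul_leadingCoeff_pow n hp, coeff_mul_C]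

theorem irreducible_integralNormalization {R : Type*} [CommRing R] [IsDomain R] {p : R[X]}
    (hp : Prime p) (hdeg : 1 ≤ p.natDegree) : Irreducible p.integralNormalization := by
  have hmonic := monic_integralNormalization hp.ne_zero
  have hlc : p.leadingCoeff ≠ 0 := leadingCoeff_ne_zero.2 hp.ne_zero
  refine (hmonic.irreducible_iff_natDegree' ).2 ⟨fun h => ?_, fun f g hf hg hfg hmem => ?_⟩
  · have := natDegree_integralNormalization (p := p)
    rw [h, natDegree_one] at this
    omega
  rw [natDegree_integralNormalization, Finset.mem_Ioc] at hmem
  have hadd := congrArg natDegree hfg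
  rw [hf.natDegree_mul hg, natDegree_integralNormalization] at hadd
  have key : ∀ q : R[X], q.Monic → p ∣ q.comp (C p.leadingCoeff * X) →
      p.natDegree ≤ q.natDegree := by
    intro q hq hdvd
    have hnd : (q.comp (C p.leadingCoeff * X)).natDegree = q.natDegree := by
      rw [natDegree_comp, natDegree_C_mul_X _ hlc, mul_one]
    rw [← hnd]
    refine natDegree_le_of_dvd hdvd fun h => ?_
    have := congrArg (coeff · q.natDegree) h
    simp [comp_C_mul_X_coeff, hq.coeff_natDegree, hlc] at this
  have hdvd : p ∣ f.comp (C p.leadingCoeff * X) * g.comp (C p.leadingCoeff * X) := by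
    rw [← mul_comp, hfg, integralNormalization_comp_C_leadingCoeff_mul_X hdeg]
    exact dvd_mul_right _ _
  rcases hp.dvd_or_dvd hdvd with h | h
  · have := key f hf h
    omega
  · have := key g hg h
    omega

/-- Clearing denominators in a bivariate polynomial. -/
theorem exists_map_mapRingHom_eq_C_mul {A k : Type*} [CommRing A] [IsDomain A] [Field k]
    [Algebra A k] [IsFractionRing A k] (f : k[X][X]) :
    ∃ (c : k) (g : A[X][X]), c ≠ 0 ∧ g.map (mapRingHom (algebraMap A k)) = C (C c) * f := by
  have key : ∀ p : k[X][X], ∃ c : A, c ≠ 0 ∧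
      ∃ g : A[X][X], g.map (mapRingHom (algebraMap A k)) = C (C (algebraMap A k c)) * p := by
    let _ : Algebra A[X] k[X] := Polynomial.algebra A k
    let _ : Algebra A[X][X] k[X][X] := Polynomial.algebra A[X] k[X]
    have h1 := Polynomial.isLocalization (nonZeroDivisors A) k
    have h2 := Polynomial.isLocalization ((nonZeroDivisors A).map (C : A →+* A[X])) k[X]
    intro p
    obtain ⟨⟨g, ⟨_, ⟨_, ⟨c, hc, rfl⟩, rfl⟩⟩⟩, hg⟩ := IsLocalization.surj
      (((nonZeroDivisors A).map (C : A →+* A[X])).map (C : A[X] →+* A[X][X])) p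
    refine ⟨c, nonZeroDivisors.ne_zero hc, g, ?_⟩
    rw [mul_comm]
    simpa [Polynomial.algebraMap_def] using hg.symm
  obtain ⟨c, hc, g, hg⟩ := key f
  exact ⟨_, g, by simpa using hc, hg⟩

/-- For an irreducible polynomial `f` over `k(x)`, some integral specialization of `x` only has
roots of the largest possible degree. -/
theorem exists_nat_forall_natDegree_le_finrank {k : Type*} [Field k] [NumberField k]
    {f : k[X][X]} (hf : Prime f) (hdeg : 1 ≤ f.natDegree) :
    ∃ i : ℕ, ∀ (L : Type _) [Field L] [Algebra k L] [FiniteDimensional k L] (z : L),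
      eval₂ (algebraMap k L) z (f.map (evalRingHom (i : k))) = 0 →
        f.natDegree ≤ Module.finrank k L := by
  obtain ⟨c, f₂, hc, hf₂⟩ := exists_map_mapRingHom_eq_C_mul (A := 𝓞 k) f
  set f₃ : k[X][X] := C (C c) * f with hf₃
  have hinj : Function.Injective (mapRingHom (algebraMap (𝓞 k) k)) :=
    map_injective _ (FaithfulSMul.algebraMap_injective _ _)
  have hprime : Prime f₃ := by
    refine (Associated.prime_iff ?_).2 hf
    have hu : IsUnit (C (C c) : k[X][X]) := ((isUnit_iff_ne_zero.2 hc).map C).map C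
    exact associated_unit_mul_left f _ hu
  have hdeg₃ : f₃.natDegree = f.natDegree := natDegree_C_mul (by simpa using hc)
  have hdeg₂ : f₂.natDegree = f.natDegree := by
    rw [← hdeg₃, ← hf₂, natDegree_map_eq_of_injective hinj]
  have hf₂0 : f₂ ≠ 0 := by
    rintro rfl
    simp at hdeg₂
    omega
  have hmap : f₂.integralNormalization.map (mapRingHom (algebraMap (𝓞 k) k)) =
      f₃.integralNormalization := by
    rw [← hf₂, integralNormalization_map]
    exact fun h => hf₂0 (leadingCoeff_eq_zero.1 (hinj (h.trans (map_zero _).symm)))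
  have hmonic := monic_integralNormalization hf₂0
  obtain ⟨i, hi⟩ := exists_nat_irreducible_map_eval hmonic
    (hmap ▸ irreducible_integralNormalization hprime (by omega))
  refine ⟨i, fun L _ _ _ z hz => ?_⟩
  have hi' := ((hmonic.map _).irreducible_iff_irreducible_map_fraction_map (K := k)).1 hi
  have hcomp : (algebraMap (𝓞 k) k).comp (evalRingHom (i : 𝓞 k)) =
      (evalRingHom (i : k)).comp (mapRingHom (algebraMap (𝓞 k) k)) := by
    ext x
    · simp
    · simp
  rw [map_map, hcomp, ← map_map, hmap] at hi'
  have hmonic₃ := monic_integralNormalization hprime.ne_zero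
  have hroot : aeval ((algebraMap k L).comp (evalRingHom (i : k)) f₃.leadingCoeff * z)
      (f₃.integralNormalization.map (evalRingHom (i : k))) = 0 := by
    rw [aeval_def, eval₂_map, integralNormalization_eval₂_leadingCoeff_mul (by omega),
      ← eval₂_map, hf₃, Polynomial.map_mul, eval₂_mul, hz, mul_zero, mul_zero]
  have hmin := minpoly.eq_of_irreducible_of_monic hi' hroot (hmonic₃.map _)
  have hle := minpoly.natDegree_le (A := k)
    ((algebraMap k L).comp (evalRingHom (i : k)) f₃.leadingCoeff * z)
  rwa [← hmin, hmonic₃.natDegree_map, natDegree_integralNormalization, hdeg₃] at hle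

end Polynomial

/-- **Quadratic arithmetic progressions on smooth plane curves of degree `4` are finite.**
Let `C : F(X,Y,Z) = 0` be a smooth projective plane curve of degree `4` (a smooth plane quartic) over a number
field `k`.  Then there is no infinite quadratic arithmetic progression sequence on `C`:
there is no infinite sequence of pairwise distinct points `P i = (x i : 1 : z i)` on `C`,
each defined over an extension of `k` of degree at most `2` (i.e. lying in `Γ₂(C,k)`), whose
`x`-coordinates form a arithmetic progression `x i = t' + (i+1) * t` with `t, t' ∈ k*`. -/
theorem quadratic_arithmetic_progression_on_plane_quartic_is_finite
    (k : Type) [Field k] [NumberField k]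
    (F : MvPolynomial (Fin 3) k) (hF : IsSmoothPlaneCurve 4 F)
    (t t' : k) (ht : t ≠ 0) (ht' : t' ≠ 0)
    (P : ℕ → Fin 3 → AlgebraicClosure k) (hinj : Function.Injective P)
    (honC : ∀ i, eval (P i) (map (algebraMap k (AlgebraicClosure k)) F) = 0)
    (hx : ∀ i, P i 0 = algebraMap k (AlgebraicClosure k) (t' + (i + 1 : ℕ) * t))
    (hy : ∀ i, P i 1 = 1)
    (hquad : ∀ i,
      Module.finrank k (IntermediateField.adjoin k (Set.range (P i))) ≤ 2) :
    False := by
  have hprime := prime_planeSubst (b := t' + t) ht (by norm_num) hF.1 (hF.irreducible (by norm_num))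
  have hdeg : 3 ≤ (planeSubst t (t' + t) F).natDegree := hF.le_natDegree_planeSubst ht
  obtain ⟨i, hi⟩ := Polynomial.exists_nat_forall_natDegree_le_finrank hprime (by omega)
  have : FiniteDimensional k (IntermediateField.adjoin k (Set.range (P i))) :=
    IntermediateField.finiteDimensional_adjoin fun x _ => Algebra.IsIntegral.isIntegral x
  have hz : P i 2 ∈ IntermediateField.adjoin k (Set.range (P i)) :=
    IntermediateField.subset_adjoin k _ ⟨2, rfl⟩
  have hle := hi (IntermediateField.adjoin k (Set.range (P i))) ⟨P i 2, hz⟩ (by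
    rw [eval₂_planeSubst]
    apply (algebraMap (IntermediateField.adjoin k (Set.range (P i)))
      (AlgebraicClosure k)).injective
    rw [← aeval_algebraMap_apply, map_zero, ← honC i, eval_map, ← aeval_def]
    congr 2
    funext j
    fin_cases j
    · simp [hx]
      ring
    · simp [hy]
    · rfl)
  exact absurd (hle.trans (hquad i)) (by omega)
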